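/- arXiv:1305.2983 — 3 statements merged into one kernel-verified Lean document; each statement's English description precedes it below -/
import Mathlib

section
/- Let p, q ≥ 2 be coprime integers and let r ≥ 2 be an integer. Set δ = gcd(pq − p − q, r), a = r/δ and b = (pq − p − q)/δ. Then the following three divisibility conditions hold simultaneously if and only if a = 2: (i) δ divides (a − 2)·p·q, (ii) a·δ divides (a − 2)·p, and (iii) a·δ divides (a − 2)·q. Equivalently, the three rational numbers ((a−2)pq)/δ + b, ((a−2)p)/(aδ) and ((a−2)q)/(aδ) are all integers if and only if a = 2. -/
/-- If a multiple `a * d ≥ 2` of a positive `a` divides both `(a - 2) * p` and `(a - 2) * q` with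
`p`, `q` coprime, then it divides `a - 2`, which forces `a = 2`. -/
theorem eq_two_of_mul_dvd_sub_two_mul {p q a d : ℤ} (hpq : IsCoprime p q) (ha : 0 < a)
    (hd : 0 < d) (had : 2 ≤ a * d) (h₁ : a * d ∣ (a - 2) * p) (h₂ : a * d ∣ (a - 2) * q) :
    a = 2 := by
  obtain ⟨u, v, huv⟩ := hpq
  have h : a * d ∣ a - 2 := by
    have h₃ := dvd_add (h₁.mul_left u) (h₂.mul_left v)
    rwa [show u * ((a - 2) * p) + v * ((a - 2) * q) = a - 2 by
      linear_combination (a - 2) * huv] at h₃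
  have hle : a ≤ a * d := le_mul_of_one_le_right ha.le hd
  have h₀ : a - 2 = 0 := Int.eq_zero_of_abs_lt_dvd h (abs_lt.2 ⟨by omega, by omega⟩)
  omega

/-- If a quotient of integers by a nonzero integer is an integer, the denominator divides. -/
theorem dvd_of_ratCast_div_eq {n d m : ℤ} (hd : d ≠ 0) (h : (n : ℚ) / d = m) : d ∣ n := by
  have hd' : (d : ℚ) ≠ 0 := by exact_mod_cast hd
  rw [div_eq_iff hd'] at h
  exact ⟨m, by rw [mul_comm]; exact_mod_cast h⟩

/-- Let `p, q ≥ 2` be coprime integers and `r ≥ 2` an integer. Set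
`δ = gcd (p*q - p - q) r`, `a = r / δ` and `b = (p*q - p - q) / δ`.  Then the three
divisibility conditions `δ ∣ (a-2)*p*q`, `a*δ ∣ (a-2)*p` and `a*δ ∣ (a-2)*q` hold
simultaneously if and only if `a = 2`; equivalently, the three rational numbers
`((a-2)*p*q)/δ + b`, `((a-2)*p)/(a*δ)` and `((a-2)*q)/(a*δ)` are all integers
if and only if `a = 2`. -/
theorem stmt_3 (p q r : ℤ) (hp : 2 ≤ p) (hq : 2 ≤ q) (hr : 2 ≤ r)
    (hpq : IsCoprime p q) (δ a b : ℤ)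
    (hδ : δ = Int.gcd (p * q - p - q) r) (ha : a = r / δ)
    (hb : b = (p * q - p - q) / δ) :
    ((δ ∣ (a - 2) * p * q ∧ a * δ ∣ (a - 2) * p ∧ a * δ ∣ (a - 2) * q) ↔ a = 2) ∧
    (((∃ m : ℤ, ((a - 2 : ℚ) * p * q) / δ + b = m) ∧
      (∃ m : ℤ, ((a - 2 : ℚ) * p) / (a * δ) = m) ∧
      (∃ m : ℤ, ((a - 2 : ℚ) * q) / (a * δ) = m)) ↔ a = 2) := by
  have hd : 0 < δ := by
    rw [hδ]
    exact_mod_cast Int.gcd_pos_of_ne_zero_right _ (by omega)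
  have hr' : a * δ = r := by
    rw [ha]
    exact Int.ediv_mul_cancel (hδ ▸ Int.gcd_dvd_right _ _)
  have ha₀ : 0 < a := pos_of_mul_pos_left (by omega : 0 < a * δ) hd.le
  have had : 2 ≤ a * δ := hr' ▸ hr
  refine ⟨⟨fun ⟨_, h₁, h₂⟩ => eq_two_of_mul_dvd_sub_two_mul hpq ha₀ hd had h₁ h₂, ?_⟩,
    ⟨fun ⟨_, ⟨m, hm⟩, ⟨n, hn⟩⟩ => eq_two_of_mul_dvd_sub_two_mul hpq ha₀ hd had
      (dvd_of_ratCast_div_eq (m := m) (by omega) (by push_cast; exact hm))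
      (dvd_of_ratCast_div_eq (m := n) (by omega) (by push_cast; exact hn)), ?_⟩⟩
  · intro h
    simp [h]
  · intro h
    have h' : (a : ℚ) - 2 = 0 := by simp [h]
    exact ⟨⟨b, by simp [h']⟩, ⟨0, by simp [h']⟩, ⟨0, by simp [h']⟩⟩
end

section
/- Let p, q ≥ 2 be coprime integers and set δ = pq − p − q. Then 11 − 2p − 2q − δ·(2δ + 1) ≡ 0 (mod 12) if and only if the pair of residues (p mod 12, q mod 12) belongs to the set {(1,4), (1,10), (2,5), (4,1), (5,2), (5,8), (8,5), (10,1)}. -/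
/-- Coprime integers leave residues modulo `n` whose gcd is coprime to `n`. -/
theorem gcd_emod_gcd_eq_one_of_isCoprime {p q : ℤ} (h : IsCoprime p q) (n : ℤ) :
    Int.gcd (Int.gcd (p % n) (q % n)) n = 1 := by
  rw [← Nat.dvd_one, ← Int.isCoprime_iff_gcd_eq_one.1 h]
  set d := Int.gcd (Int.gcd (p % n) (q % n)) n
  have hd : (d : ℤ) ∣ Int.gcd (p % n) (q % n) := Int.gcd_dvd_left ..
  have hn : (d : ℤ) ∣ n := Int.gcd_dvd_right ..
  exact Int.dvd_gcd ((EuclideanDomain.dvd_mod_iff hn).1 (hd.trans (Int.gcd_dvd_left ..)))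
    ((EuclideanDomain.dvd_mod_iff hn).1 (hd.trans (Int.gcd_dvd_right ..)))

/-- Among residue pairs modulo 12 that can come from coprime integers, the ones satisfying the
congruence are exactly those in the list. -/
theorem residue_congruence_iff : ∀ a ∈ Finset.Ico (0 : ℤ) 12, ∀ b ∈ Finset.Ico (0 : ℤ) 12,
    Int.gcd (Int.gcd a b) 12 = 1 →
      ((11 - 2 * a - 2 * b - (a * b - a - b) * (2 * (a * b - a - b) + 1)) % 12 = 0 ↔
        (a, b) ∈ ({(1, 4), (1, 10), (2, 5), (4, 1), (5, 2), (5, 8), (8, 5), (10, 1)} :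
          Finset (ℤ × ℤ))) := by
  decide +kernel

/-- Let `p, q ≥ 2` be coprime integers and set `δ = p*q - p - q`. Then
`11 - 2p - 2q - δ*(2δ + 1) ≡ 0 (mod 12)` if and only if the pair of residues
`(p % 12, q % 12)` belongs to `{(1,4), (1,10), (2,5), (4,1), (5,2), (5,8), (8,5), (10,1)}`. -/
theorem stmt_8 (p q : ℤ) (hp : 2 ≤ p) (hq : 2 ≤ q) (hpq : IsCoprime p q)
    (δ : ℤ) (hδ : δ = p * q - p - q) :
    11 - 2 * p - 2 * q - δ * (2 * δ + 1) ≡ 0 [ZMOD 12] ↔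
      (p % 12, q % 12) ∈
        ({(1, 4), (1, 10), (2, 5), (4, 1), (5, 2), (5, 8), (8, 5), (10, 1)} :
          Set (ℤ × ℤ)) := by
  subst hδ
  have ha : p % 12 ≡ p [ZMOD 12] := Int.mod_modEq p 12
  have hb : q % 12 ≡ q [ZMOD 12] := Int.mod_modEq q 12
  have hd := ((ha.mul hb).sub ha).sub hb
  have hE := (((Int.ModEq.refl 11).sub (ha.mul_left 2)).sub (hb.mul_left 2)).sub
    (hd.mul ((hd.mul_left 2).add_right 1))
  have key := residue_congruence_iff (p % 12) (by simp; omega) (q % 12) (by simp; omega)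
    (gcd_emod_gcd_eq_one_of_isCoprime hpq 12)
  rw [← Finset.mem_coe] at key
  push_cast at key
  rw [← key, Int.ModEq, ← hE, Int.zero_emod]
end

section
/- Let p, q, r be integers with p, q, r ≥ 2 and gcd(p,q) = 1, and define F : ℂ³ → ℂ by F(x,y,z) = conj(x·y)·(x^p + y^q) + z^r, where conj denotes complex conjugation. Then F (viewed as a map of real manifolds ℝ⁶ → ℝ²) has no critical point away from the origin: for every v = (x,y,z) ∈ ℂ³ with v ≠ 0, the real Fréchet derivative of F at v, i.e. the ℝ-linear map fderiv_ℝ F v : ℂ³ → ℂ, is surjective. -/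
open ComplexConjugate

/-- A non-surjective real-linear map into `ℂ` has image in a real line through the origin. -/
theorem LinearMap.exists_re_mul_eq_zero_of_not_surjective {E : Type*} [AddCommGroup E]
    [Module ℝ E] (L : E →ₗ[ℝ] ℂ) (hL : ¬ Function.Surjective L) :
    ∃ u : ℂ, u ≠ 0 ∧ ∀ h, (u * L h).re = 0 := by
  have hlt : LinearMap.range L < ⊤ := by
    rw [lt_top_iff_ne_top]
    exact fun h => hL (LinearMap.range_eq_top.mp h)
  obtain ⟨f, hf, hker⟩ := Submodule.exists_le_ker_of_lt_top _ hlt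
  have hfw : ∀ w : ℂ, f w = w.re * f 1 + w.im * f Complex.I := by
    intro w
    have hw : w = w.re • (1 : ℂ) + w.im • Complex.I := by simp
    conv_lhs => rw [hw]
    rw [map_add, map_smul, map_smul, smul_eq_mul, smul_eq_mul]
  refine ⟨⟨f 1, -f Complex.I⟩, ?_, ?_⟩
  · intro hu
    apply hf
    ext w
    have h1 := congrArg Complex.re hu
    have h2 := congrArg Complex.im hu
    simp only [Complex.zero_re, Complex.zero_im, neg_eq_zero] at h1 h2
    simp [hfw w, h1, h2]
  · intro h
    have h0 : f (L h) = 0 := hker (LinearMap.mem_range_self L h)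
    rw [hfw] at h0
    simp only [Complex.mul_re]
    linarith

theorem Complex.add_conj_eq_zero_of_re_mul_eq_zero {u a b : ℂ}
    (h : ∀ w : ℂ, (u * (a * w + b * conj w)).re = 0) : u * a + conj (u * b) = 0 := by
  have h1 := h 1
  have h2 := h Complex.I
  simp at h1 h2
  apply Complex.ext
  · simp
    linarith
  · simp
    linarith

theorem hasFDerivAt_conj_mul_mul_add_pow (p q r : ℕ) (x y z : ℂ) :
    ∃ L : ℂ × ℂ × ℂ →L[ℝ] ℂ,
      HasFDerivAt (fun v : ℂ × ℂ × ℂ =>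
        conj (v.1 * v.2.1) * (v.1 ^ p + v.2.1 ^ q) + v.2.2 ^ r) L (x, y, z) ∧
      ∀ a b c : ℂ, L (a, b, c) =
        conj (x * y) * (p * x ^ (p - 1) * a + q * y ^ (q - 1) * b) +
          conj (x * b + y * a) * (x ^ p + y ^ q) + r * z ^ (r - 1) * c := by
  have hx : HasFDerivAt (fun v : ℂ × ℂ × ℂ => v.1) (ContinuousLinearMap.fst ℝ ℂ (ℂ × ℂ))
      (x, y, z) := hasFDerivAt_fst
  have hyz : HasFDerivAt (fun v : ℂ × ℂ × ℂ => v.2) (ContinuousLinearMap.snd ℝ ℂ (ℂ × ℂ))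
      (x, y, z) := hasFDerivAt_snd
  have hc := (Complex.conjCLE : ℂ ≃L[ℝ] ℂ).hasFDerivAt.comp (x, y, z) (hx.mul hyz.fst)
  refine ⟨_, (hc.mul ((hx.pow p).add (hyz.fst.pow q))).add (hyz.snd.pow r), ?_⟩
  intro a b c
  simp
  ring

/-- The two equations express that `conj (x * y) * (x ^ p + y ^ q)` is critical at `(x, y)`. -/
theorem eq_zero_of_critical_equations {p q : ℕ} (hp : 2 ≤ p) (hq : 2 ≤ q)
    (hpq : Nat.Coprime p q) {u x y : ℂ} (hu : u ≠ 0)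
    (h1 : u * (conj (x * y) * (p * x ^ (p - 1))) + conj (u * (conj y * (x ^ p + y ^ q))) = 0)
    (h2 : u * (conj (x * y) * (q * y ^ (q - 1))) + conj (u * (conj x * (x ^ p + y ^ q))) = 0) :
    x = 0 ∧ y = 0 := by
  have hp0 : p ≠ 0 := by omega
  have hq0 : q ≠ 0 := by omega
  by_cases hx : x = 0
  · simpa [hx, hu, hp0, hq0] using h1
  by_cases hy : y = 0
  · simpa [hy, hu, hp0, hq0] using h2
  exfalso
  have hxp : x * x ^ (p - 1) = x ^ p := mul_pow_sub_one hp0 x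
  have hyq : y * y ^ (q - 1) = y ^ q := mul_pow_sub_one hq0 y
  simp only [map_mul, Complex.conj_conj] at h1 h2
  have hcx : conj x ≠ 0 := (map_ne_zero _).mpr hx
  have hcy : conj y ≠ 0 := (map_ne_zero _).mpr hy
  have hA : (p : ℂ) * x ^ p = q * y ^ q := by
    have hne : u * conj x * conj y ≠ 0 := mul_ne_zero (mul_ne_zero hu hcx) hcy
    apply mul_left_cancel₀ hne
    linear_combination x * h1 - y * h2 - u * conj x * conj y * (p * hxp - q * hyq)
  have hS : (q : ℂ) * (x ^ p + y ^ q) = (p + q) * x ^ p := by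
    linear_combination -hA
  have hnS : (q : ℝ) * ‖x ^ p + y ^ q‖ = (p + q) * ‖x ^ p‖ := by
    have h := congrArg norm hS
    rw [norm_mul, norm_mul, ← Nat.cast_add, Complex.norm_natCast, Complex.norm_natCast] at h
    rw [h]
    push_cast
    ring
  have hn1 : (p : ℝ) * ‖x ^ p‖ = ‖x ^ p + y ^ q‖ := by
    have h := congrArg norm (eq_neg_of_add_eq_zero_left h1)
    simp only [norm_neg, norm_mul, RCLike.norm_conj, Complex.norm_natCast] at h
    have hne : ‖u‖ * ‖y‖ ≠ 0 := by simp [hu, hy]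
    apply mul_left_cancel₀ hne
    rw [← hxp, norm_mul, hxp]
    linear_combination h
  have hnx : ‖x ^ p‖ ≠ 0 := by simp [hx]
  have hR : (q : ℝ) * p = p + q := by
    apply mul_right_cancel₀ hnx
    linear_combination hnS + q * hn1
  have hN : q * p = p + q := by exact_mod_cast hR
  have hp2 : p = 2 := by nlinarith
  have hq2 : q = 2 := by nlinarith
  simp [hp2, hq2] at hpq


/-- Let `p, q, r ≥ 2` with `gcd(p,q) = 1` and `F(x,y,z) = conj(x*y)*(x^p + y^q) + z^r`.
Then `F`, viewed as a map of real manifolds `ℝ⁶ → ℝ²`, has no critical point away from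
the origin: for every `v ≠ 0` the real Fréchet derivative of `F` at `v` is surjective. -/
theorem stmt_13 (p q r : ℕ) (hp : 2 ≤ p) (hq : 2 ≤ q) (hr : 2 ≤ r)
    (hpq : Nat.Coprime p q) (F : ℂ × ℂ × ℂ → ℂ)
    (hF : ∀ x y z : ℂ,
      F (x, y, z) = (starRingEnd ℂ) (x * y) * (x ^ p + y ^ q) + z ^ r) :
    ∀ v : ℂ × ℂ × ℂ, v ≠ 0 → Function.Surjective (fderiv ℝ F v) := by
  have hF' : F = fun v : ℂ × ℂ × ℂ =>
      conj (v.1 * v.2.1) * (v.1 ^ p + v.2.1 ^ q) + v.2.2 ^ r := by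
    funext ⟨x, y, z⟩
    exact hF x y z
  rintro ⟨x, y, z⟩ hv
  obtain ⟨L, hL, hLa⟩ := hasFDerivAt_conj_mul_mul_add_pow p q r x y z
  rw [hF', hL.fderiv]
  by_contra hns
  obtain ⟨u, hu, hre⟩ :=
    LinearMap.exists_re_mul_eq_zero_of_not_surjective (L : ℂ × ℂ × ℂ →ₗ[ℝ] ℂ) hns
  have hre' : ∀ a b c : ℂ, (u * L (a, b, c)).re = 0 := fun a b c => hre (a, b, c)
  have h1 := Complex.add_conj_eq_zero_of_re_mul_eq_zero (u := u)
    (a := conj (x * y) * (p * x ^ (p - 1))) (b := conj y * (x ^ p + y ^ q)) (fun w => by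
      rw [← hre' w 0 0, hLa]
      congr 2
      simp
      ring)
  have h2 := Complex.add_conj_eq_zero_of_re_mul_eq_zero (u := u)
    (a := conj (x * y) * (q * y ^ (q - 1))) (b := conj x * (x ^ p + y ^ q)) (fun w => by
      rw [← hre' 0 w 0, hLa]
      congr 2
      simp
      ring)
  have h3 := Complex.add_conj_eq_zero_of_re_mul_eq_zero (u := u)
    (a := r * z ^ (r - 1)) (b := 0) (fun w => by
      rw [← hre' 0 0 w, hLa]
      congr 2
      simp)
  have hz : z = 0 := by
    have hr0 : r ≠ 0 := by omega
    simp [hu, hr0] at h3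
    exact h3.1
  obtain ⟨hx, hy⟩ := eq_zero_of_critical_equations hp hq hpq hu h1 h2
  exact hv (by simp [hx, hy, hz])
end
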